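/- arXiv:1501.03028 — 9 statements merged into one kernel-verified Lean document; each statement's English description precedes it below -/
import Mathlib

section
/- Soundness: For every signature Σ = (V,E,{P_e}) and every formula φ ∈ Φ(Σ), if ⊢ φ in the proof system for Σ, then r ⊩ φ for every protocol 𝒫 over Σ and every run r of 𝒫. -/
/- Formulas of the language Φ(Σ): atoms are indexed by a type `P` of
propositional symbols; `edgeOf p` is the unique edge `e` with `p ∈ P_e`
(this encodes a pairwise disjoint family `{P_e}_{e ∈ E}`). -/
inductive Form (E P : Type) : Type
  | bot : Form E P
  | atom : P → Form E P
  | imp : Form E P → Form E P → Form E P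
  | box : E → Form E P → Form E P

namespace Form
/-- ¬φ abbreviates φ → ⊥. -/
def neg {E P : Type} (φ : Form E P) : Form E P := imp φ bot
/-- φ ∨ ψ abbreviates ¬φ → ψ. -/
def or {E P : Type} (φ ψ : Form E P) : Form E P := imp (neg φ) ψ
end Form

/-- An undirected multigraph is given by `inc : E → V × V` sending each edge to
its (two, possibly equal) ends.  `Incident inc e v` says `v` is an end of `e`. -/
def Incident {V E : Type} (inc : E → V × V) (e : E) (v : V) : Prop :=
  (inc e).1 = v ∨ (inc e).2 = v

/-- Adjacency using only edges from the set `S`. -/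
def AdjVia {V E : Type} (inc : E → V × V) (S : Set E) (u v : V) : Prop :=
  ∃ e ∈ S, inc e = (u, v) ∨ inc e = (v, u)

/-- Reachability using only edges from the set `S`. -/
def ReachableVia {V E : Type} (inc : E → V × V) (S : Set E) : V → V → Prop :=
  Relation.ReflTransGen (AdjVia inc S)

/-- The graph is connected. -/
def ConnectedGraph {V E : Type} (inc : E → V × V) : Prop :=
  ∀ u v : V, ReachableVia inc Set.univ u v

/-- A path `e₀, v₁, e₁, …, v_k, e_k`: distinct edges, distinct vertices, with
`e_i, e_{i+1}` incident to `v_{i+1}` for `0 ≤ i < k`. -/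
structure GPath (V E : Type) (inc : E → V × V) where
  edges : List E
  verts : List V
  len_eq : edges.length = verts.length + 1
  edges_nodup : edges.Nodup
  verts_nodup : verts.Nodup
  incid_left : ∀ i (hi : i < verts.length),
    Incident inc (edges.get ⟨i, by omega⟩) (verts.get ⟨i, hi⟩)
  incid_right : ∀ i (hi : i < verts.length),
    Incident inc (edges.get ⟨i + 1, by omega⟩) (verts.get ⟨i, hi⟩)

/-- `g` is a gateway between `A` and `B`: every path that starts with an edge
in `A` and ends with an edge in `B` contains the edge `g`. -/
def IsGateway {V E : Type} (inc : E → V × V) (A B : Set E) (g : E) : Prop :=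
  ∀ p : GPath V E inc, ∀ hne : p.edges ≠ [],
    p.edges.head hne ∈ A → p.edges.getLast hne ∈ B → g ∈ p.edges

/-- The sublanguage Φ(Σ,T). -/
inductive InLang {E P : Type} (edgeOf : P → E) (T : Set E) : Form E P → Prop
  | bot : InLang edgeOf T Form.bot
  | atom (p : P) : edgeOf p ∈ T → InLang edgeOf T (Form.atom p)
  | imp {φ ψ : Form E P} : InLang edgeOf T φ → InLang edgeOf T ψ →
      InLang edgeOf T (Form.imp φ ψ)
  | box (t : E) (φ : Form E P) : t ∈ T → InLang edgeOf T (Form.box t φ)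

/-- Evaluation of a formula under a truth assignment `v` that treats atoms and
boxed formulas as atomic. -/
def evalWith {E P : Type} (v : Form E P → Prop) : Form E P → Prop
  | Form.bot => False
  | Form.imp φ ψ => evalWith v φ → evalWith v ψ
  | φ => v φ

/-- Propositional tautology. -/
def Tautology {E P : Type} (φ : Form E P) : Prop := ∀ v, evalWith v φ

/-- The proof system: propositional tautologies, Truth, Positive Introspection,
Negative Introspection, Distributivity, Gateway; Modus Ponens, Necessitation. -/
inductive Deriv {V E P : Type} (inc : E → V × V) (edgeOf : P → E) : Form E P → Prop
  | taut {φ : Form E P} : Tautology φ → Deriv inc edgeOf φ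
  | truth (e : E) (φ : Form E P) : Deriv inc edgeOf (Form.imp (Form.box e φ) φ)
  | posIntro (e : E) (φ : Form E P) :
      Deriv inc edgeOf (Form.imp (Form.box e φ) (Form.box e (Form.box e φ)))
  | negIntro (e : E) (φ : Form E P) :
      Deriv inc edgeOf (Form.imp (Form.neg (Form.box e φ)) (Form.box e (Form.neg (Form.box e φ))))
  | distrib (e : E) (φ ψ : Form E P) :
      Deriv inc edgeOf (Form.imp (Form.box e (Form.imp φ ψ))
        (Form.imp (Form.box e φ) (Form.box e ψ)))
  | gateway {A B : Set E} {g e : E} {φ ψ : Form E P} :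
      IsGateway inc A B g → e ∈ A → InLang edgeOf A φ → InLang edgeOf B ψ →
      Deriv inc edgeOf (Form.imp (Form.box e (Form.imp φ ψ)) (Form.imp φ (Form.box g ψ)))
  | mp {φ ψ : Form E P} : Deriv inc edgeOf (Form.imp φ ψ) → Deriv inc edgeOf φ →
      Deriv inc edgeOf ψ
  | nec (e : E) {φ : Form E P} : Deriv inc edgeOf φ → Deriv inc edgeOf (Form.box e φ)

/-- `X ⊢ φ`: derivable from assumptions `X` using theorems of the system and
Modus Ponens only. -/
inductive DerivFrom {V E P : Type} (inc : E → V × V) (edgeOf : P → E)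
    (X : Set (Form E P)) : Form E P → Prop
  | ax {φ : Form E P} : Deriv inc edgeOf φ → DerivFrom inc edgeOf X φ
  | hyp {φ : Form E P} : φ ∈ X → DerivFrom inc edgeOf X φ
  | mp {φ ψ : Form E P} : DerivFrom inc edgeOf X (Form.imp φ ψ) →
      DerivFrom inc edgeOf X φ → DerivFrom inc edgeOf X ψ

/-- A protocol over the signature: a set of values `W e` for each channel `e`,
local conditions `L v` at each vertex, and a valuation `π`. -/
structure Protocol {V E P : Type} (inc : E → V × V) (edgeOf : P → E) where
  W : E → Type
  L : (v : V) → Set ((e : {e : E // Incident inc e v}) → W e.1)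
  pi : (p : P) → Set (W (edgeOf p))

/-- A run of a protocol. -/
def IsRun {V E P : Type} {inc : E → V × V} {edgeOf : P → E}
    (Pr : Protocol inc edgeOf) (r : (e : E) → Pr.W e) : Prop :=
  ∀ v : V, (fun e : {e : E // Incident inc e v} => r e.1) ∈ Pr.L v

def Run {V E P : Type} {inc : E → V × V} {edgeOf : P → E}
    (Pr : Protocol inc edgeOf) : Type :=
  {r : (e : E) → Pr.W e // IsRun Pr r}

/-- Satisfaction `r ⊩ φ`. -/
def Sat {V E P : Type} {inc : E → V × V} {edgeOf : P → E}
    (Pr : Protocol inc edgeOf) : Run Pr → Form E P → Prop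
  | _, Form.bot => False
  | r, Form.atom p => r.1 (edgeOf p) ∈ Pr.pi p
  | r, Form.imp φ ψ => Sat Pr r φ → Sat Pr r ψ
  | r, Form.box e φ => ∀ r' : Run Pr, r'.1 e = r.1 e → Sat Pr r' φ

namespace GPath

variable {V E : Type} {inc : E → V × V}

theorem edges_ne_nil (p : GPath V E inc) : p.edges ≠ [] := by
  have := p.len_eq
  intro h
  simp [h] at this

/-- The path consisting of a single edge. -/
def single (inc : E → V × V) (e : E) : GPath V E inc where
  edges := [e]
  verts := []
  len_eq := rfl
  edges_nodup := by simp
  verts_nodup := by simp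
  incid_left := by simp
  incid_right := by simp

/-- The initial segment of a path with `i` inner vertices. -/
def take (p : GPath V E inc) (i : ℕ) (hi : i ≤ p.verts.length) : GPath V E inc where
  edges := p.edges.take (i + 1)
  verts := p.verts.take i
  len_eq := by
    have := p.len_eq
    simp only [List.length_take]
    omega
  edges_nodup := p.edges_nodup.sublist (List.take_sublist _ _)
  verts_nodup := p.verts_nodup.sublist (List.take_sublist _ _)
  incid_left j hj := by
    have hlt : j < p.verts.length := by simp only [List.length_take] at hj; omega
    simpa using p.incid_left j hlt
  incid_right j hj := by
    have hlt : j < p.verts.length := by simp only [List.length_take] at hj; omega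
    simpa using p.incid_right j hlt

/-- Extension of a path by a new edge through a new vertex. -/
def snoc (p : GPath V E inc) (v : V) (f : E) (hv : v ∉ p.verts) (hf : f ∉ p.edges)
    (hlast : Incident inc (p.edges.getLast p.edges_ne_nil) v) (hfv : Incident inc f v) :
    GPath V E inc where
  edges := p.edges ++ [f]
  verts := p.verts ++ [v]
  len_eq := by simp [p.len_eq]
  edges_nodup := by
    simpa [List.nodup_append, p.edges_nodup] using fun _ ha => ne_of_mem_of_not_mem ha hf
  verts_nodup := by
    simpa [List.nodup_append, p.verts_nodup] using fun _ ha => ne_of_mem_of_not_mem ha hv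
  incid_left i hi := by
    have hlen := p.len_eq
    have hi' : i < p.edges.length := by simp at hi; omega
    rcases Nat.lt_or_ge i p.verts.length with h | h
    · simpa [List.getElem_append, h, hi'] using p.incid_left i h
    · have hil : i = p.verts.length := by omega
      subst hil
      simpa [List.getElem_append, List.getLast_eq_getElem, hlen] using hlast
  incid_right i hi := by
    have hlen := p.len_eq
    rcases Nat.lt_or_ge i p.verts.length with h | h
    · simpa [List.getElem_append, h, hlen] using p.incid_right i h
    · have hil : i = p.verts.length := by simp at hi; omega
      subst hil
      simpa [List.getElem_append, hlen] using hfv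

end GPath

/-- Edges at which some path starting in `A` and avoiding `g` ends. -/
def pathReach {V E : Type} (inc : E → V × V) (A : Set E) (g : E) : Set E :=
  {f | ∃ p : GPath V E inc, p.edges.head p.edges_ne_nil ∈ A ∧ g ∉ p.edges ∧
    p.edges.getLast p.edges_ne_nil = f}

section pathReach

variable {V E : Type} {inc : E → V × V} {A B : Set E} {g : E}

theorem mem_pathReach_of_mem {e : E} (he : e ∈ A) (hne : e ≠ g) : e ∈ pathReach inc A g :=
  ⟨GPath.single inc e, by simpa [GPath.single] using he, by simpa [GPath.single] using hne.symm,
    by simp [GPath.single]⟩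

theorem IsGateway.notMem_pathReach (hg : IsGateway inc A B g) {f : E} (hf : f ∈ B) :
    f ∉ pathReach inc A g := by
  rintro ⟨p, hA, hgp, rfl⟩
  exact hgp (hg p p.edges_ne_nil hA hf)

theorem ne_of_mem_pathReach {f : E} (hf : f ∈ pathReach inc A g) : f ≠ g := by
  rintro rfl
  obtain ⟨p, -, hgp, hlast⟩ := hf
  exact hgp (hlast ▸ List.getLast_mem _)

theorem mem_pathReach_of_incident {f f' : E} {v : V} (hf : f ∈ pathReach inc A g)
    (hfv : Incident inc f v) (hfv' : Incident inc f' v) (hne : f' ≠ g) :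
    f' ∈ pathReach inc A g := by
  classical
  obtain ⟨p, hA, hgp, rfl⟩ := hf
  have hlen := p.len_eq
  -- Cut the path at its first edge incident to `v`.
  have hex : ∃ i, ∃ h : i < p.edges.length, Incident inc p.edges[i] v :=
    ⟨p.edges.length - 1, by omega, by simpa [List.getLast_eq_getElem] using hfv⟩
  obtain ⟨hi, hiv⟩ := Nat.find_spec hex
  have hmin := fun m hm => Nat.find_min (m := m) hex hm
  generalize Nat.find hex = i at hi hiv hmin
  have hle : i ≤ p.verts.length := by omega
  have hlast : (p.take i hle).edges.getLast (p.take i hle).edges_ne_nil = p.edges[i] := by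
    simp only [GPath.take, List.getLast_eq_getElem, List.getElem_take, List.length_take]
    congr 1
    omega
  have hhead : (p.take i hle).edges.head (p.take i hle).edges_ne_nil ∈ A := by
    simpa [GPath.take, List.head_take] using hA
  have hgt : g ∉ (p.take i hle).edges := fun h => hgp (List.mem_of_mem_take h)
  by_cases hfi : p.edges[i] = f'
  · exact ⟨p.take i hle, hhead, hgt, hlast.trans hfi⟩
  have hv : v ∉ (p.take i hle).verts := by
    intro h
    obtain ⟨j, hj, hjv⟩ := List.mem_iff_getElem.1 h
    simp only [GPath.take, List.length_take, List.getElem_take] at hj hjv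
    have := p.incid_left j (by omega)
    exact hmin j (by omega) ⟨by omega, by simpa [hjv] using this⟩
  have hf : f' ∉ (p.take i hle).edges := by
    intro h
    obtain ⟨j, hj, hjf⟩ := List.mem_iff_getElem.1 h
    simp only [GPath.take, List.length_take, List.getElem_take] at hj hjf
    rcases Nat.lt_or_ge j i with hji | hji
    · exact hmin j hji ⟨by omega, by rwa [hjf]⟩
    · have hij : j = i := by omega
      subst hij
      exact hfi hjf
  refine ⟨(p.take i hle).snoc v f' hv hf (hlast ▸ hiv) hfv', ?_, ?_, ?_⟩
  · simpa [GPath.snoc, List.head_append, GPath.edges_ne_nil] using hhead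
  · simpa [GPath.snoc] using ⟨hgt, hne.symm⟩
  · simp [GPath.snoc]

end pathReach

/-- Two runs that agree on a gateway can be glued along it. -/
theorem IsGateway.exists_run {V E P : Type} {inc : E → V × V} {edgeOf : P → E} {A B : Set E}
    {g : E} (hg : IsGateway inc A B g) (Pr : Protocol inc edgeOf) (r r' : Run Pr)
    (h : r'.1 g = r.1 g) :
    ∃ s : Run Pr, (∀ e ∈ A, s.1 e = r.1 e) ∧ ∀ e ∈ B, s.1 e = r'.1 e := by
  classical
  let w : (e : E) → Pr.W e := fun e => if e ∈ pathReach inc A g then r.1 e else r'.1 e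
  have hwg : w g = r'.1 g := if_neg fun hmem => ne_of_mem_pathReach hmem rfl
  refine ⟨⟨w, fun v => ?_⟩, fun e he => ?_, fun e he => if_neg (hg.notMem_pathReach he)⟩
  · by_cases hv : ∃ f ∈ pathReach inc A g, Incident inc f v
    · obtain ⟨f, hf, hfv⟩ := hv
      convert r.2 v using 1
      funext ⟨e, he⟩
      by_cases heg : e = g
      · subst heg
        exact hwg.trans h
      · exact if_pos (mem_pathReach_of_incident hf hfv he heg)
    · convert r'.2 v using 1
      funext ⟨e, he⟩
      exact if_neg fun hmem => hv ⟨e, hmem, he⟩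
  · by_cases heg : e = g
    · subst heg
      exact hwg.trans h
    · exact if_pos (mem_pathReach_of_mem he heg)

section Sat

variable {V E P : Type} {inc : E → V × V} {edgeOf : P → E}

theorem InLang.sat_congr {T : Set E} {φ : Form E P} (hφ : InLang edgeOf T φ)
    (Pr : Protocol inc edgeOf) {r s : Run Pr} (h : ∀ e ∈ T, s.1 e = r.1 e) :
    Sat Pr s φ ↔ Sat Pr r φ := by
  induction hφ with
  | bot => simp [Sat]
  | atom p hp => simp [Sat, h _ hp]
  | imp _ _ ih₁ ih₂ => simp [Sat, ih₁, ih₂]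
  | box t φ ht => simp [Sat, h _ ht]

theorem evalWith_sat (Pr : Protocol inc edgeOf) (r : Run Pr) (φ : Form E P) :
    evalWith (Sat Pr r) φ ↔ Sat Pr r φ := by
  induction φ with
  | bot => simp [evalWith, Sat]
  | atom p => simp [evalWith]
  | imp φ ψ ih₁ ih₂ => simp [evalWith, Sat, ih₁, ih₂]
  | box e φ => simp [evalWith]

end Sat

/-- Soundness: if ⊢ φ in the proof system for the signature,
then r ⊩ φ for every protocol 𝒫 over the signature and every run r of 𝒫. -/
theorem soundness {V E P : Type} (inc : E → V × V) (edgeOf : P → E)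
    (hconn : ConnectedGraph inc) (φ : Form E P)
    (hφ : Deriv inc edgeOf φ) :
    ∀ (Pr : Protocol inc edgeOf) (r : Run Pr), Sat Pr r φ := by
  intro Pr
  induction hφ with
  | taut h => exact fun r => (evalWith_sat Pr r _).1 (h _)
  | truth e φ => exact fun r h => h r rfl
  | posIntro e φ => exact fun r h r' h' r'' h'' => h r'' (h''.trans h')
  | negIntro e φ => exact fun r h r' h' hbox => h fun s hs => hbox s (hs.trans h'.symm)
  | distrib e φ ψ => exact fun r h₁ h₂ r' h' => h₁ r' h' (h₂ r' h')
  | gateway hg he hφ hψ =>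
    intro r h hr r' h'
    obtain ⟨s, hsA, hsB⟩ := hg.exists_run Pr r r' h'
    exact (hψ.sat_congr Pr hsB).1 (h s (hsA _ he) ((hφ.sat_congr Pr hsA).2 hr))
  | mp _ _ ih₁ ih₂ => exact fun r => ih₁ r (ih₂ r)
  | nec e _ ih => exact fun r r' _ => ih r'
end

section
/- Soundness of the Gateway axiom: For every signature Σ = (V,E,{P_e}), every run r of a protocol 𝒫 over Σ, every edge g that is a gateway between sets of edges A ⊆ E and B ⊆ E, every a ∈ A, and all formulas φ ∈ Φ(Σ,A) and ψ ∈ Φ(Σ,B), if r ⊩ □_a(φ→ψ) and r ⊩ φ, then r ⊩ □_gψ. -/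
theorem Sat.congr {V E P : Type} {inc : E → V × V} {edgeOf : P → E}
    {Pr : Protocol inc edgeOf} {T : Set E} {φ : Form E P} (hφ : InLang edgeOf T φ)
    {r s : Run Pr} (h : ∀ e ∈ T, r.1 e = s.1 e) : Sat Pr r φ ↔ Sat Pr s φ := by
  induction hφ with
  | bot => simp only [Sat]
  | atom p hp => simp only [Sat, h _ hp]
  | imp _ _ ih₁ ih₂ => simp only [Sat, ih₁, ih₂]
  | box t φ ht => simp only [Sat, h _ ht]

/-- `AvoidingPath inc A g es vs` says that `es` and `vs` list, last element first, the edges and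
the vertices of a path that starts with an edge of `A` and does not contain `g`. -/
inductive AvoidingPath {V E : Type} (inc : E → V × V) (A : Set E) (g : E) :
    List E → List V → Prop
  | single {a : E} : a ∈ A → a ≠ g → AvoidingPath inc A g [a] []
  | cons {e f : E} {es : List E} {v : V} {vs : List V} :
      AvoidingPath inc A g (e :: es) vs → Incident inc e v → Incident inc f v →
      f ∉ e :: es → v ∉ vs → f ≠ g → AvoidingPath inc A g (f :: e :: es) (v :: vs)

namespace AvoidingPath

variable {V E : Type} {inc : E → V × V} {A : Set E} {g : E} {es : List E} {vs : List V}

theorem length_eq (h : AvoidingPath inc A g es vs) : es.length = vs.length + 1 := by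
  induction h with
  | single => rfl
  | cons _ _ _ _ _ _ ih => simpa using ih

theorem nodup_edges (h : AvoidingPath inc A g es vs) : es.Nodup := by
  induction h with
  | single => simp
  | cons _ _ _ hf _ _ ih => exact List.nodup_cons.2 ⟨hf, ih⟩

theorem nodup_verts (h : AvoidingPath inc A g es vs) : vs.Nodup := by
  induction h with
  | single => simp
  | cons _ _ _ _ hv _ ih => exact List.nodup_cons.2 ⟨hv, ih⟩

theorem notMem (h : AvoidingPath inc A g es vs) : g ∉ es := by
  induction h with
  | single _ ha => simpa using ha.symm
  | cons _ _ _ _ _ hf ih => exact List.not_mem_cons_of_ne_of_not_mem hf.symm ih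

theorem getLast_mem (h : AvoidingPath inc A g es vs) (hne : es ≠ []) : es.getLast hne ∈ A := by
  induction h with
  | single ha => simpa using ha
  | cons _ _ _ _ _ _ ih => simpa using ih (by simp)

theorem incident (h : AvoidingPath inc A g es vs) :
    ∀ i (hi : i < vs.length) (h₀ : i < es.length) (h₁ : i + 1 < es.length),
      Incident inc es[i] vs[i] ∧ Incident inc es[i + 1] vs[i] := by
  induction h with
  | single => simp
  | cons _ he hf _ _ _ ih =>
    rintro (_ | i) hi h₀ h₁
    · exact ⟨hf, he⟩
    · exact ih i (Nat.lt_of_succ_lt_succ hi) (Nat.lt_of_succ_lt_succ h₀)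
        (Nat.lt_of_succ_lt_succ h₁)

theorem exists_gPath (h : AvoidingPath inc A g es vs) :
    ∃ p : GPath V E inc, p.edges = es.reverse := by
  have hlen := h.length_eq
  refine ⟨⟨es.reverse, vs.reverse, by simpa using hlen, List.nodup_reverse.2 h.nodup_edges,
    List.nodup_reverse.2 h.nodup_verts, fun i hi => ?_, fun i hi => ?_⟩, rfl⟩ <;>
    simp only [List.length_reverse] at hi <;>
    simp only [List.get_eq_getElem, List.getElem_reverse]
  · convert (h.incident (vs.length - 1 - i) (by omega) (by omega) (by omega)).2 using 2
    omega
  · convert (h.incident (vs.length - 1 - i) (by omega) (by omega) (by omega)).1 using 2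
    omega

theorem notMem_of_isGateway {B : Set E} (hg : IsGateway inc A B g) {e : E}
    (h : AvoidingPath inc A g (e :: es) vs) : e ∉ B := by
  intro he
  obtain ⟨p, hp⟩ := h.exists_gPath
  have hne : p.edges ≠ [] := by simp [hp]
  refine h.notMem (List.mem_reverse.1 (hp ▸ hg p hne ?_ ?_))
  · simpa only [hp, List.head_reverse] using h.getLast_mem (by simp)
  · simpa only [hp, List.getLast_reverse, List.head_cons] using he

theorem exists_of_mem (h : AvoidingPath inc A g es vs) {f : E} (hf : f ∈ es) :
    ∃ es' vs', AvoidingPath inc A g (f :: es') vs' := by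
  induction h with
  | single ha hag =>
    obtain rfl := List.mem_singleton.1 hf
    exact ⟨_, _, .single ha hag⟩
  | cons h he hf' hn hv hfg ih =>
    rcases List.mem_cons.1 hf with rfl | hf
    · exact ⟨_, _, .cons h he hf' hn hv hfg⟩
    · exact ih hf

theorem exists_of_mem_verts (h : AvoidingPath inc A g es vs) {f : E} {v : V} (hv : v ∈ vs)
    (hf : Incident inc f v) (hn : f ∉ es) (hfg : f ≠ g) :
    ∃ es' vs', AvoidingPath inc A g (f :: es') vs' := by
  induction h with
  | single => simp at hv
  | cons h he _ _ hw _ ih =>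
    have hn' := List.not_mem_of_not_mem_cons hn
    rcases List.mem_cons.1 hv with rfl | hv
    · exact ⟨_, _, .cons h he hf hn' hw hfg⟩
    · exact ih hv hn'

theorem exists_of_incident {e f : E} {v : V} (h : AvoidingPath inc A g (e :: es) vs)
    (he : Incident inc e v) (hf : Incident inc f v) (hfg : f ≠ g) :
    ∃ es' vs', AvoidingPath inc A g (f :: es') vs' := by
  by_cases hn : f ∈ e :: es
  · exact h.exists_of_mem hn
  by_cases hv : v ∈ vs
  · exact h.exists_of_mem_verts hv hf hn hfg
  · exact ⟨_, _, .cons h he hf hn hv hfg⟩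

end AvoidingPath

/-- If `C` contains, with each of its edges, all edges other than `g` sharing an end with it, then
two runs agreeing on `g` can be glued along `C`. -/
theorem Run.exists_glue {V E P : Type} {inc : E → V × V} {edgeOf : P → E}
    {Pr : Protocol inc edgeOf} {C : Set E} {g : E}
    (hC : ∀ e ∈ C, ∀ f v, Incident inc e v → Incident inc f v → f ≠ g → f ∈ C)
    (r s : Run Pr) (hg : s.1 g = r.1 g) :
    ∃ t : Run Pr, (∀ e ∈ C, t.1 e = r.1 e) ∧ (∀ e ∉ C, t.1 e = s.1 e) := by
  classical
  refine ⟨⟨fun e => if e ∈ C then r.1 e else s.1 e, fun v => ?_⟩,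
    fun e he => if_pos he, fun e he => if_neg he⟩
  by_cases hv : ∃ e ∈ C, Incident inc e v
  · obtain ⟨e, he, hev⟩ := hv
    convert r.2 v using 1
    funext f
    by_cases hf : f.1 ∈ C
    · exact if_pos hf
    · have hfg : f.1 = g := by_contra fun hne => hf (hC e he f.1 v hev f.2 hne)
      simp only [if_neg hf]
      rw [hfg, hg]
  · convert s.2 v using 1
    funext f
    exact if_neg fun hf => hv ⟨f.1, hf, f.2⟩

/-- Soundness of the Gateway axiom: if g is a gateway between A
and B, a ∈ A, φ ∈ Φ(Σ,A), ψ ∈ Φ(Σ,B), r ⊩ □_a(φ→ψ) and r ⊩ φ, then r ⊩ □_gψ. -/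
theorem gateway_sound {V E P : Type} (inc : E → V × V) (edgeOf : P → E)
    (hconn : ConnectedGraph inc) (Pr : Protocol inc edgeOf)
    (A B : Set E) (g : E) (hg : IsGateway inc A B g)
    (a : E) (ha : a ∈ A) (φ ψ : Form E P)
    (hφ : InLang edgeOf A φ) (hψ : InLang edgeOf B ψ)
    (r : Run Pr)
    (h1 : Sat Pr r (Form.box a (Form.imp φ ψ)))
    (h2 : Sat Pr r φ) :
    Sat Pr r (Form.box g ψ) := by
  intro s hs
  let C : Set E := {e | ∃ es vs, AvoidingPath inc A g (e :: es) vs}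
  have hC : ∀ e ∈ C, ∀ f v, Incident inc e v → Incident inc f v → f ≠ g → f ∈ C := by
    rintro e ⟨es, vs, h⟩ f v he hf hfg
    exact h.exists_of_incident he hf hfg
  obtain ⟨t, htr, hts⟩ := Run.exists_glue hC r s hs
  have hA : ∀ e ∈ A, t.1 e = r.1 e := by
    intro e he
    by_cases heC : e ∈ C
    · exact htr e heC
    · have heg : e = g := by_contra fun hne => heC ⟨_, _, .single he hne⟩
      rw [hts e heC, heg, hs]
  have hB : ∀ e ∈ B, t.1 e = s.1 e := by
    refine fun e he => hts e ?_
    rintro ⟨es, vs, h⟩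
    exact h.notMem_of_isGateway hg he
  exact (Sat.congr hψ hB).1 (h1 t (hA a ha) ((Sat.congr hφ hA).2 h2))
end

section
/- For any signature Σ = (V,E,{P_e}) whose graph is the linear graph with four vertices p,q,u,v and three edges a ∈ Edge(p,q), b ∈ Edge(q,u), c ∈ Edge(u,v), and any formula φ ∈ Φ(Σ): ⊢ □_a(□_bφ ∨ □_cφ) → □_bφ (where φ∨ψ abbreviates ¬φ→ψ and ¬φ abbreviates φ→⊥). -/
/-- Monotonicity of the modality along a derivable implication. -/
theorem Deriv.box_mono {V E P : Type} {inc : E → V × V} {edgeOf : P → E} (e : E)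
    {φ ψ : Form E P} (h : Deriv inc edgeOf (Form.imp φ ψ)) :
    Deriv inc edgeOf (Form.imp (Form.box e φ) (Form.box e ψ)) :=
  .mp (.distrib e φ ψ) (.nec e h)

/-- In a graph with the three edges `a`, `b`, `c` in which `a` and `c` share no end, `b` is a
gateway between `{a, b}` and `{c}`. -/
theorem isGateway_middle {V E : Type} {inc : E → V × V} {a b c : E}
    (hE : ∀ e : E, e = a ∨ e = b ∨ e = c) (hac : a ≠ c)
    (hdisj : ∀ x : V, Incident inc a x → ¬ Incident inc c x) :
    IsGateway inc {a, b} {c} b := by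
  intro path hne hhead hlast
  obtain ⟨edges, verts, hlen, hnd, hvnd, hl, hr⟩ := path
  by_contra hb
  rcases edges with _ | ⟨x, _ | ⟨y, es⟩⟩
  · exact hne rfl
  · simp_all
    grind
  rcases verts with _ | ⟨w, ws⟩
  · simp at hlen
  · have h0 := hl 0 (by simp)
    have h1 := hr 0 (by simp)
    simp only [List.get_eq_getElem, List.getElem_cons_zero, zero_add,
      List.getElem_cons_succ] at h0 h1
    have hx : x = a := by
      rcases hhead with h | h
      · exact h
      · exact absurd (by simp [show x = b from h]) hb
    have hy : y = c := by
      rcases hE y with h | h | h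
      · subst hx h
        simp at hnd
      · exact absurd (by simp [h]) hb
      · exact h
    subst hx hy
    exact hdisj w h0 h1

/-- for the linear graph with four vertices p,q,u,v and three
edges a ∈ Edge(p,q), b ∈ Edge(q,u), c ∈ Edge(u,v):
⊢ □_a(□_bφ ∨ □_cφ) → □_bφ. -/
theorem linear_three {V E P : Type} (inc : E → V × V) (edgeOf : P → E)
    (hconn : ConnectedGraph inc)
    (p q u v : V) (a b c : E)
    (hV : ∀ x : V, x = p ∨ x = q ∨ x = u ∨ x = v)
    (hE : ∀ e : E, e = a ∨ e = b ∨ e = c)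
    (hVnd : ([p, q, u, v] : List V).Nodup)
    (hEnd : ([a, b, c] : List E).Nodup)
    (ha : inc a = (p, q) ∨ inc a = (q, p))
    (hb : inc b = (q, u) ∨ inc b = (u, q))
    (hc : inc c = (u, v) ∨ inc c = (v, u))
    (φ : Form E P) :
    Deriv inc edgeOf (Form.imp
      (Form.box a (Form.or (Form.box b φ) (Form.box c φ)))
      (Form.box b φ)) := by
  have hdisj : ∀ x : V, Incident inc a x → ¬ Incident inc c x := by
    intro x
    simp only [List.nodup_cons, List.mem_cons, List.not_mem_nil, or_false, not_or] at hVnd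
    unfold Incident
    rcases ha with ha | ha <;> rcases hc with hc | hc <;> rw [ha, hc] <;> grind
  have hac : a ≠ c := by
    rintro rfl
    simp at hEnd
  have hgate : Deriv inc edgeOf (Form.imp
      (Form.box a (Form.or (Form.box b φ) (Form.box c φ)))
      (Form.imp (Form.neg (Form.box b φ)) (Form.box b (Form.box c φ)))) :=
    .gateway (isGateway_middle hE hac hdisj) (by simp)
      (.imp (.box b φ (by simp)) .bot) (.box c φ (by simp))
  have hmono : Deriv inc edgeOf (Form.imp (Form.box b (Form.box c φ)) (Form.box b φ)) :=
    .box_mono b (.truth c φ)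
  refine .mp (.mp (.taut fun w => ?_) hgate) hmono
  simp only [evalWith, Form.neg]
  tauto
end

section
/- For any signature Σ = (V,E,{P_e}) whose graph is the linear graph with six vertices and five edges a, b, e, d, c appearing in that order along a simple path, and any formula φ ∈ Φ(Σ): ⊢ □_a□_e□_cφ → □_b□_dφ. -/
/-- An edge `g` separating a set `S` of edges, closed under adjacency up to `g`, from `B`
is a gateway between any subset of `S` and `B`. -/
theorem isGateway_of_separates {V E : Type} {inc : E → V × V} {A B : Set E} {g : E} (S : Set E)
    (hA : A ⊆ S) (hB : Disjoint B S)
    (hS : ∀ e ∈ S, ∀ f v, Incident inc e v → Incident inc f v → f ∈ S ∨ f = g) :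
    IsGateway inc A B g := by
  intro p hne hhead hlast
  by_contra hg
  have key : ∀ i (hi : i < p.edges.length), p.edges[i] ∈ S := by
    intro i
    induction i with
    | zero =>
      intro hi
      rw [← List.head_eq_getElem hne]
      exact hA hhead
    | succ i ih =>
      intro hi
      have hi' : i < p.verts.length := by have := p.len_eq; omega
      rcases hS _ (ih (by omega)) _ _ (p.incid_left i hi') (p.incid_right i hi') with h | h
      · exact h
      · exact absurd (h ▸ List.getElem_mem hi) hg
  refine Set.disjoint_left.mp hB hlast ?_
  rw [List.getLast_eq_getElem]
  exact key _ _

namespace Deriv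

variable {V E P : Type} {inc : E → V × V} {edgeOf : P → E}

theorem imp_trans {φ ψ χ : Form E P} (h₁ : Deriv inc edgeOf (Form.imp φ ψ))
    (h₂ : Deriv inc edgeOf (Form.imp ψ χ)) : Deriv inc edgeOf (Form.imp φ χ) := by
  refine mp (mp (taut ?_) h₁) h₂
  intro v
  simp only [evalWith]
  tauto

theorem box_mono_s7 (e : E) {φ ψ : Form E P} (h : Deriv inc edgeOf (Form.imp φ ψ)) :
    Deriv inc edgeOf (Form.imp (Form.box e φ) (Form.box e ψ)) :=
  mp (distrib e φ ψ) (nec e h)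

/-- Knowledge at `e` of a statement about `B` passes to any gateway between `e` and `B`. -/
theorem box_gateway {B : Set E} {e g : E} {ψ : Form E P} (hg : IsGateway inc {e} B g)
    (hψ : InLang edgeOf B ψ) : Deriv inc edgeOf (Form.imp (Form.box e ψ) (Form.box g ψ)) := by
  have hweak : Deriv inc edgeOf (Form.imp ψ (Form.imp (Form.neg Form.bot) ψ)) := by
    refine taut fun v => ?_
    simp only [evalWith]
    tauto
  have hgate : Deriv inc edgeOf (Form.imp (Form.box e (Form.imp (Form.neg Form.bot) ψ))
      (Form.imp (Form.neg Form.bot) (Form.box g ψ))) :=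
    gateway hg rfl (.imp .bot .bot) hψ
  refine imp_trans (box_mono_s7 e hweak) (imp_trans hgate (taut fun v => ?_))
  simp only [evalWith, Form.neg]
  tauto

end Deriv

/-- for the linear graph with six vertices v₀,…,v₅ and five edges
a, b, e, d, c appearing in that order along a simple path:
⊢ □_a□_e□_cφ → □_b□_dφ. -/
theorem linear_five {V E P : Type} (inc : E → V × V) (edgeOf : P → E)
    (hconn : ConnectedGraph inc)
    (v0 v1 v2 v3 v4 v5 : V) (ea eb ee ed ec : E)
    (hV : ∀ x : V, x = v0 ∨ x = v1 ∨ x = v2 ∨ x = v3 ∨ x = v4 ∨ x = v5)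
    (hE : ∀ e : E, e = ea ∨ e = eb ∨ e = ee ∨ e = ed ∨ e = ec)
    (hVnd : ([v0, v1, v2, v3, v4, v5] : List V).Nodup)
    (hEnd : ([ea, eb, ee, ed, ec] : List E).Nodup)
    (ha : inc ea = (v0, v1) ∨ inc ea = (v1, v0))
    (hb : inc eb = (v1, v2) ∨ inc eb = (v2, v1))
    (he : inc ee = (v2, v3) ∨ inc ee = (v3, v2))
    (hd : inc ed = (v3, v4) ∨ inc ed = (v4, v3))
    (hc : inc ec = (v4, v5) ∨ inc ec = (v5, v4))
    (φ : Form E P) :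
    Deriv inc edgeOf (Form.imp
      (Form.box ea (Form.box ee (Form.box ec φ)))
      (Form.box eb (Form.box ed φ))) := by
  simp only [List.nodup_cons, List.mem_cons, List.not_mem_nil, or_false, not_or] at hVnd hEnd
  have hab : IsGateway inc {ea} {ee} eb := by
    refine isGateway_of_separates {ea} subset_rfl ?_ ?_
    · simpa using Ne.symm hEnd.1.2.1
    · rintro _ rfl f v hv hf
      unfold Incident at hv hf
      rcases hE f with rfl | rfl | rfl | rfl | rfl <;> grind
  have hed : IsGateway inc {ee} {ec} ed := by
    refine isGateway_of_separates {ea, eb, ee} (by simp) ?_ ?_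
    · simp only [Set.disjoint_singleton_left, Set.mem_insert_iff, Set.mem_singleton_iff]
      grind
    · intro e hes f v hv hf
      simp only [Set.mem_insert_iff, Set.mem_singleton_iff] at hes ⊢
      unfold Incident at hv hf
      rcases hE f with rfl | rfl | rfl | rfl | rfl <;> grind
  have hbox : Deriv inc edgeOf
      (Form.imp (Form.box ee (Form.box ec φ)) (Form.box ed φ)) :=
    (Deriv.box_gateway hed (.box ec φ rfl)).imp_trans (Deriv.box_mono_s7 ed (.truth ec φ))
  exact (Deriv.box_gateway hab (.box ee _ rfl)).imp_trans (Deriv.box_mono_s7 eb hbox)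
end

section
/- For any signature Σ = (V,E,{P_e}) whose graph has vertices p,q,u,v,s,t and edges m ∈ Edge(p,q), two parallel edges k,c ∈ Edge(q,u), m' ∈ Edge(u,v), two parallel edges k',c' ∈ Edge(v,s), and m'' ∈ Edge(s,t), and any formula φ ∈ Φ(Σ): ⊢ □_m□_{m''}φ → □_{m'}□_{m''}φ. -/
/-- If `S` contains `A`, misses `B`, and is closed under passing to a neighbouring edge other
than `g`, then `g` is a gateway between `A` and `B`. -/
theorem isGateway_of_closed {V E : Type} {inc : E → V × V} {A B S : Set E} {g : E}
    (hA : A ⊆ S) (hB : Disjoint B S)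
    (hS : ∀ e f : E, ∀ x : V, e ∈ S → f ≠ g → Incident inc e x → Incident inc f x → f ∈ S) :
    IsGateway inc A B g := by
  intro π hne hhead hlast
  by_contra hg
  have mem : ∀ i (hi : i < π.edges.length), π.edges.get ⟨i, hi⟩ ∈ S := by
    intro i
    induction i with
    | zero =>
      intro hi
      simpa [List.head_eq_getElem] using hA hhead
    | succ i ih =>
      intro hi
      have hlen := π.len_eq
      refine hS _ _ _ (ih (by omega)) ?_ (π.incid_left i (by omega)) (π.incid_right i (by omega))
      rintro rfl
      exact hg (List.get_mem _ _)
  refine Set.disjoint_left.mp hB hlast ?_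
  rw [List.getLast_eq_getElem]
  exact mem _ (by have := π.len_eq; omega)

/-- Knowledge on one side of a gateway of a formula about the other side is shared by the
gateway. -/
theorem Deriv.box_imp_box_of_isGateway {V E P : Type} {inc : E → V × V} {edgeOf : P → E}
    {A B : Set E} {g e : E} {ψ : Form E P} (hg : IsGateway inc A B g) (he : e ∈ A)
    (hψ : InLang edgeOf B ψ) :
    Deriv inc edgeOf (Form.imp (Form.box e ψ) (Form.box g ψ)) := by
  have weaken : Deriv inc edgeOf (Form.imp (Form.box e ψ)
      (Form.box e (Form.imp (Form.neg Form.bot) ψ))) :=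
    .mp (.distrib e _ _) (.nec e (.taut fun _ h _ => h))
  have gate := Deriv.gateway (edgeOf := edgeOf) (φ := Form.neg Form.bot) hg he
    (.imp .bot .bot) hψ
  have chain (α β γ : Form E P) : Deriv inc edgeOf (Form.imp (Form.imp α β)
      (Form.imp (Form.imp β (Form.imp (Form.neg Form.bot) γ)) (Form.imp α γ))) :=
    .taut fun _ h₁ h₂ a => h₂ (h₁ a) id
  exact .mp (.mp (chain _ _ _) weaken) gate

/-- for the graph with vertices p,q,u,v,s,t and edges
m ∈ Edge(p,q), parallel edges k,c ∈ Edge(q,u), m' ∈ Edge(u,v), parallel edges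
k',c' ∈ Edge(v,s), and m'' ∈ Edge(s,t): ⊢ □_m□_{m''}φ → □_{m'}□_{m''}φ.
(Here m' is denoted m1, m'' is m2, k' is k1 and c' is c1.) -/
theorem double_diamond {V E P : Type} (inc : E → V × V) (edgeOf : P → E)
    (hconn : ConnectedGraph inc)
    (p q u v s t : V) (m k c m1 k1 c1 m2 : E)
    (hV : ∀ x : V, x = p ∨ x = q ∨ x = u ∨ x = v ∨ x = s ∨ x = t)
    (hE : ∀ e : E, e = m ∨ e = k ∨ e = c ∨ e = m1 ∨ e = k1 ∨ e = c1 ∨ e = m2)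
    (hVnd : ([p, q, u, v, s, t] : List V).Nodup)
    (hEnd : ([m, k, c, m1, k1, c1, m2] : List E).Nodup)
    (hm : inc m = (p, q) ∨ inc m = (q, p))
    (hk : inc k = (q, u) ∨ inc k = (u, q))
    (hc : inc c = (q, u) ∨ inc c = (u, q))
    (hm1 : inc m1 = (u, v) ∨ inc m1 = (v, u))
    (hk1 : inc k1 = (v, s) ∨ inc k1 = (s, v))
    (hc1 : inc c1 = (v, s) ∨ inc c1 = (s, v))
    (hm2 : inc m2 = (s, t) ∨ inc m2 = (t, s))
    (φ : Form E P) :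
    Deriv inc edgeOf (Form.imp
      (Form.box m (Form.box m2 φ))
      (Form.box m1 (Form.box m2 φ))) := by
  refine Deriv.box_imp_box_of_isGateway (A := {m}) (B := {m2})
    (isGateway_of_closed (S := {m, k, c}) (by simp) ?_ ?_) rfl (.box m2 φ rfl)
  · simp only [List.nodup_cons, List.mem_cons] at hEnd
    simp only [Set.disjoint_singleton_left, Set.mem_insert_iff, Set.mem_singleton_iff]
    grind
  · simp only [List.nodup_cons, List.mem_cons] at hVnd
    simp only [Set.mem_insert_iff, Set.mem_singleton_iff]
    intro e f x he hf hex hfx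
    have left : x = p ∨ x = q ∨ x = u := by
      unfold Incident at hex
      grind
    unfold Incident at hfx
    have := hE f
    grind
end

section
/- For any signature Σ = (V,E,{P_e}), any edge e ∈ E, and any formula φ ∈ Φ(Σ,{e}): ⊢ φ → □_eφ. -/
/-- for any edge e and any φ ∈ Φ(Σ,{e}): ⊢ φ → □_eφ. -/
theorem local_box {V E P : Type} (inc : E → V × V) (edgeOf : P → E)
    (hconn : ConnectedGraph inc)
    (e : E) (φ : Form E P) (hφ : InLang edgeOf {e} φ) :
    Deriv inc edgeOf (Form.imp φ (Form.box e φ)) := by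
  have hg : IsGateway inc {e} {e} e := fun p hne hA _ =>
    (Set.mem_singleton_iff.mp hA) ▸ List.head_mem hne
  exact .mp (.gateway hg rfl hφ hφ) (.nec e (.taut fun _ h => h))
end

section
/- For any signature Σ = (V,E,{P_e}), any edge e ∈ E, any set of formulas X ⊆ Φ(Σ,{e}), and any formula φ ∈ Φ(Σ): if X ⊢ φ then X ⊢ □_eφ. -/
theorem Deriv.box_self_of_inLang {V E P : Type} {inc : E → V × V} {edgeOf : P → E}
    {e : E} {φ : Form E P} (hφ : InLang edgeOf {e} φ) :
    Deriv inc edgeOf (Form.imp φ (Form.box e φ)) := by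
  have hg : IsGateway inc {e} {e} e := fun p hne hhead _ =>
    (Set.mem_singleton_iff.mp hhead) ▸ List.head_mem hne
  exact .mp (.gateway hg rfl hφ hφ) (.nec e (.taut fun _ h => h))

/-- for any edge e, any X ⊆ Φ(Σ,{e}) and any φ ∈ Φ(Σ):
if X ⊢ φ then X ⊢ □_eφ. -/
theorem box_from_local {V E P : Type} (inc : E → V × V) (edgeOf : P → E)
    (hconn : ConnectedGraph inc)
    (e : E) (X : Set (Form E P)) (hX : ∀ φ ∈ X, InLang edgeOf {e} φ)
    (φ : Form E P) (h : DerivFrom inc edgeOf X φ) :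
    DerivFrom inc edgeOf X (Form.box e φ) := by
  induction h with
  | ax h => exact .ax (.nec e h)
  | hyp h => exact .mp (.ax (Deriv.box_self_of_inLang (hX _ h))) (.hyp h)
  | mp _ _ ih₁ ih₂ => exact .mp (.mp (.ax (.distrib e _ _)) ih₁) ih₂
end

section
/- Gateway-zero lemma for canonical protocols: Let ⟨X^e, {f^e_u}_{u∈Inc(e)}⟩_{e∈E} be a run of the canonical protocol 𝒫^δ_F. If h ∈ F is a bridge with ends v and v', and δ_h ∉ X^h, then f^h_v = 0 if and only if □_hδ ∉ X^h. -/
/-- Big disjunction of a list of formulas. -/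
def bigDisj {E P : Type} : List (Form E P) → Form E P
  | [] => Form.bot
  | φ :: l => Form.or φ (bigDisj l)

/-- The disjunction ⋁_{e ∈ s} δ_e. -/
noncomputable def disjOver {E P : Type} (s : Finset E) (d : E → Form E P) : Form E P :=
  bigDisj (s.toList.map d)

/-- The formula δ = ⋁_{e ∈ E} δ_e. -/
noncomputable def deltaForm {E P : Type} [Fintype E] (d : E → Form E P) : Form E P :=
  disjOver Finset.univ d

/-- ⋁_{h ∈ S} δ_h for a set of edges `S`. -/
noncomputable def disjSet {E P : Type} [Fintype E] (d : E → Form E P) (S : Set E) : Form E P :=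
  disjOver (Set.toFinite S).toFinset d

/-- `e` is a bridge: removing it disconnects the graph. -/
def IsBridge {V E : Type} (inc : E → V × V) (e : E) : Prop :=
  ¬ ∀ u v : V, ReachableVia inc {x | x ≠ e} u v

/-- Edges of the connected component `C^u_{-e}` of the graph with `e` deleted
that contains the vertex `u`. -/
def compEdges {V E : Type} (inc : E → V × V) (e : E) (u : V) : Set E :=
  {h | h ≠ e ∧ ∃ w : V, Incident inc h w ∧ ReachableVia inc {x | x ≠ e} u w}

/-- `X` is consistent. -/
def ConsistentSet {V E P : Type} (inc : E → V × V) (edgeOf : P → E)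
    (X : Set (Form E P)) : Prop :=
  ¬ DerivFrom inc edgeOf X Form.bot

/-- `X` is a maximal consistent subset of Φ(Σ,T). -/
def MaxConsistentIn {V E P : Type} (inc : E → V × V) (edgeOf : P → E)
    (T : Set E) (X : Set (Form E P)) : Prop :=
  (∀ φ ∈ X, InLang edgeOf T φ) ∧ ConsistentSet inc edgeOf X ∧
    ∀ φ : Form E P, InLang edgeOf T φ → φ ∉ X →
      ¬ ConsistentSet inc edgeOf (insert φ X)

/-- `X` is a maximal consistent subset of Φ(Σ). -/
def MaxConsistent {V E P : Type} (inc : E → V × V) (edgeOf : P → E)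
    (X : Set (Form E P)) : Prop :=
  ConsistentSet inc edgeOf X ∧
    ∀ φ : Form E P, φ ∉ X → ¬ ConsistentSet inc edgeOf (insert φ X)

/-- A value of an edge under a canonical protocol 𝒫^δ_F: a set of formulas `X`
together with flow values `f₁`, `f₂` at the two ends `(inc e).1`, `(inc e).2`. -/
structure CanValue (E P : Type) where
  X : Set (Form E P)
  f₁ : ℝ
  f₂ : ℝ

/-- The defining conditions on a value of edge `e` under the canonical
protocol 𝒫^δ_F, where δ = ⋁_{e ∈ E} d e. -/
def IsCanValue {V E P : Type} [Fintype E] (inc : E → V × V) (edgeOf : P → E)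
    (d : E → Form E P) (F : Set E) (e : E) (w : CanValue E P) : Prop :=
  MaxConsistentIn inc edgeOf {e} w.X ∧
  (w.f₁ + w.f₂ > 0 ↔ d e ∈ w.X) ∧
  (IsBridge inc e → d e ∉ w.X → w.f₁ + w.f₂ = 0) ∧
  (IsBridge inc e → w.f₁ < 0 →
    Form.box e (disjSet d (compEdges inc e (inc e).1)) ∈ w.X) ∧
  (IsBridge inc e → w.f₂ < 0 →
    Form.box e (disjSet d (compEdges inc e (inc e).2)) ∈ w.X) ∧
  (IsBridge inc e → e ∈ F → Form.box e (deltaForm d) ∈ w.X → d e ∉ w.X →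
    w.f₁ < 0 ∨ w.f₂ < 0) ∧
  (¬ IsBridge inc e → w.f₁ + w.f₂ < 0 → Form.box e (deltaForm d) ∈ w.X) ∧
  (¬ IsBridge inc e → e ∈ F → Form.box e (deltaForm d) ∈ w.X → d e ∉ w.X →
    w.f₁ + w.f₂ < 0)

open Classical in
/-- The flow value `f^e_u` of edge `e` at vertex `u` (0 if `u` is not an end
of `e`; for a loop both ends contribute). -/
noncomputable def flowAt {V E P : Type} (inc : E → V × V) (w : CanValue E P)
    (e : E) (u : V) : ℝ :=
  (if (inc e).1 = u then w.f₁ else 0) + (if (inc e).2 = u then w.f₂ else 0)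

/-- The local condition of the canonical protocol at a vertex `u`:
if δ_e ∉ X^e for every edge `e` incident to `u`, then Σ_{e ∈ Inc(u)} f^e_u ≥ 0. -/
def CanLocal {V E P : Type} [Fintype E] (inc : E → V × V) (d : E → Form E P)
    (r : (e : E) → CanValue E P) (u : V) : Prop :=
  (∀ e : E, Incident inc e u → d e ∉ (r e).X) → 0 ≤ ∑ e : E, flowAt inc (r e) e u

/-- `r` is a run of the canonical protocol 𝒫^δ_F. -/
def IsCanRun {V E P : Type} [Fintype E] (inc : E → V × V) (edgeOf : P → E)
    (d : E → Form E P) (F : Set E) (r : (e : E) → CanValue E P) : Prop :=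
  (∀ e : E, IsCanValue inc edgeOf d F e (r e)) ∧ ∀ u : V, CanLocal inc d r u

/-- The set Γ_M of paths (Definition of Γ_M). -/
def InGamma {V E P : Type} [Fintype E] (inc : E → V × V) (d : E → Form E P)
    (M : Set (Form E P)) (p : GPath V E inc) : Prop :=
  0 < p.verts.length ∧
  (∀ h0 : 0 < p.verts.length,
    Form.box (p.edges.get ⟨0, by have := p.len_eq; omega⟩)
      (disjSet d (compEdges inc (p.edges.get ⟨0, by have := p.len_eq; omega⟩)
        (p.verts.get ⟨0, h0⟩))) ∈ M) ∧
  (∀ i (hi : i < p.verts.length),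
    d (p.edges.get ⟨i, by have := p.len_eq; omega⟩) ∉ M) ∧
  (∀ i (hi : i < p.verts.length),
    IsBridge inc (p.edges.get ⟨i, by have := p.len_eq; omega⟩) →
    Form.box (p.edges.get ⟨i, by have := p.len_eq; omega⟩)
      (disjSet d (compEdges inc (p.edges.get ⟨i, by have := p.len_eq; omega⟩)
        (p.verts.get ⟨i, hi⟩))) ∈ M) ∧
  (∀ hne : p.edges ≠ [], d (p.edges.getLast hne) ∈ M)

theorem evalWith_bigDisj {E P : Type} (v : Form E P → Prop) (l : List (Form E P)) :
    evalWith v (bigDisj l) ↔ ∃ φ ∈ l, evalWith v φ := by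
  induction l with
  | nil => simp [bigDisj, evalWith]
  | cons φ l ih =>
    simp only [bigDisj, Form.or, Form.neg, evalWith, ih, List.mem_cons, exists_eq_or_imp]
    tauto

theorem tautology_disjOver_mono {E P : Type} (d : E → Form E P) {s t : Finset E} (hst : s ⊆ t) :
    Tautology (Form.imp (disjOver s d) (disjOver t d)) := by
  intro v
  simp only [disjOver, evalWith, evalWith_bigDisj, List.mem_map, Finset.mem_toList]
  rintro ⟨φ, ⟨e, he, rfl⟩, hφ⟩
  exact ⟨d e, ⟨e, hst he, rfl⟩, hφ⟩

theorem DerivFrom.cut {V E P : Type} {inc : E → V × V} {edgeOf : P → E}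
    {X : Set (Form E P)} {φ ψ : Form E P} (hφ : DerivFrom inc edgeOf X φ)
    (hψ : DerivFrom inc edgeOf (insert φ X) ψ) : DerivFrom inc edgeOf X ψ := by
  induction hψ with
  | ax h => exact .ax h
  | hyp h =>
    rcases h with rfl | h
    · exact hφ
    · exact .hyp h
  | mp _ _ ih₁ ih₂ => exact .mp ih₁ ih₂

theorem MaxConsistentIn.mem_of_derivFrom {V E P : Type} {inc : E → V × V} {edgeOf : P → E}
    {T : Set E} {X : Set (Form E P)} (hX : MaxConsistentIn inc edgeOf T X) {φ : Form E P}
    (hφ : InLang edgeOf T φ) (hd : DerivFrom inc edgeOf X φ) : φ ∈ X := by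
  by_contra hn
  exact hX.2.2 φ hφ hn fun hbot => hX.2.1 (hd.cut hbot)

theorem MaxConsistentIn.box_deltaForm_mem {V E P : Type} [Fintype E] {inc : E → V × V}
    {edgeOf : P → E} {h : E} {X : Set (Form E P)} (hX : MaxConsistentIn inc edgeOf {h} X)
    {d : E → Form E P} {S : Set E} (hS : Form.box h (disjSet d S) ∈ X) :
    Form.box h (deltaForm d) ∈ X :=
  hX.mem_of_derivFrom (.box h _ rfl)
    (.mp (.ax (.mp (.distrib h _ _)
      (.nec h (.taut (tautology_disjOver_mono d (Finset.subset_univ _)))))) (.hyp hS))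

/-- Gateway-zero lemma: if r is a run of the canonical protocol
𝒫^δ_F, h ∈ F is a bridge with ends v = (inc h).1 and v' = (inc h).2, and
δ_h ∉ X^h, then f^h_v = 0 iff □_hδ ∉ X^h. -/
theorem gateway_zero {V E P : Type} [Fintype E] (inc : E → V × V) (edgeOf : P → E)
    (hconn : ConnectedGraph inc)
    (d : E → Form E P) (hd : ∀ e : E, InLang edgeOf {e} (d e))
    (F : Set E) (r : (e : E) → CanValue E P)
    (hr : IsCanRun inc edgeOf d F r)
    (h : E) (hhF : h ∈ F) (hbr : IsBridge inc h)
    (hδ : d h ∉ (r h).X) :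
    (r h).f₁ = 0 ↔ Form.box h (deltaForm d) ∉ (r h).X := by
  obtain ⟨hX, -, hsum, hneg₁, hneg₂, hF, -, -⟩ := hr.1 h
  have hzero := hsum hbr hδ
  constructor
  · intro h₁ hbox
    rcases hF hbr hhF hbox hδ with hlt | hlt <;> linarith
  · intro hbox
    by_contra hne
    rcases lt_or_gt_of_ne hne with hlt | hgt
    · exact hbox (hX.box_deltaForm_mem (hneg₁ hbr hlt))
    · exact hbox (hX.box_deltaForm_mem (hneg₂ hbr (by linarith)))
end

section
/- Sink-existence theorem: For any edge h ∈ E and any run ⟨X^e, {f^e_u}_{u∈Inc(e)}⟩_{e∈E} of the canonical protocol 𝒫^δ_{{h}}, if □_hδ ∈ X^h, then there exists an edge h' ∈ E such that δ_{h'} ∈ X^{h'}. -/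
instance {V E : Type} {inc : E → V × V} {S : Set E} : Std.Symm (AdjVia inc S) :=
  ⟨fun _ _ ⟨e, he, h⟩ => ⟨e, he, h.symm⟩⟩

theorem ReachableVia.symm {V E : Type} {inc : E → V × V} {S : Set E} {u v : V}
    (h : ReachableVia inc S u v) : ReachableVia inc S v u :=
  Relation.ReflTransGen.stdSymm.symm _ _ h

/-- In a connected graph, the ends of a bridge lie in different components once the bridge
is deleted. -/
theorem IsBridge.not_reachableVia {V E : Type} {inc : E → V × V} (hconn : ConnectedGraph inc)
    {e : E} (he : IsBridge inc e) : ¬ ReachableVia inc {x | x ≠ e} (inc e).1 (inc e).2 := by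
  intro hreach
  refine he fun u v => ?_
  induction hconn u v with
  | refl => exact .refl
  | @tail b c _ hbc ih =>
    obtain ⟨g, -, hg⟩ := hbc
    refine Relation.ReflTransGen.trans ih ?_
    by_cases hge : g = e
    · subst hge
      rcases hg with hg | hg <;> rw [hg] at hreach
      · exact hreach
      · exact hreach.symm
    · exact .single ⟨g, hge, hg⟩

open Classical in
/-- The flow of an edge into a finite set of vertices. -/
theorem sum_flowAt {V E P : Type} (inc : E → V × V) (w : CanValue E P) (e : E) (T : Finset V) :
    ∑ u ∈ T, flowAt inc w e u =
      (if (inc e).1 ∈ T then w.f₁ else 0) + (if (inc e).2 ∈ T then w.f₂ else 0) := by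
  simp [flowAt, Finset.sum_add_distrib]

/-- If no vertex of `T` has negative total flow, no edge other than `h` has positive total flow,
and no edge other than `h` leaves `T`, then `h` does not carry negative flow into `T`. -/
theorem sum_flowAt_nonneg_of_closed {V E P : Type} [Fintype E] {inc : E → V × V}
    {r : E → CanValue E P} {T : Finset V} {h : E}
    (hloc : ∀ u ∈ T, 0 ≤ ∑ e : E, flowAt inc (r e) e u)
    (hle : ∀ e ≠ h, (r e).f₁ + (r e).f₂ ≤ 0)
    (hT : ∀ e ≠ h, ((inc e).1 ∈ T ↔ (inc e).2 ∈ T)) :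
    0 ≤ ∑ u ∈ T, flowAt inc (r h) h u := by
  classical
  have htotal := Finset.sum_nonneg hloc
  rw [Finset.sum_comm, ← Finset.add_sum_erase _ _ (Finset.mem_univ h)] at htotal
  have hrest : ∑ e ∈ Finset.univ.erase h, ∑ u ∈ T, flowAt inc (r e) e u ≤ 0 := by
    refine Finset.sum_nonpos fun e he => ?_
    have hne := Finset.ne_of_mem_erase he
    rw [sum_flowAt]
    by_cases h2 : (inc e).2 ∈ T
    · simpa [hT e hne, h2] using hle e hne
    · simp [hT e hne, h2]
  linarith

open Classical in
/-- The finite set of ends of edges that are reachable from `u` without using `h`. -/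
noncomputable def componentEnds {V E : Type} [Fintype E] (inc : E → V × V) (h : E) (u : V) :
    Finset V :=
  (Finset.univ.image (fun e => (inc e).1) ∪ Finset.univ.image (fun e => (inc e).2)).filter
    (ReachableVia inc {x | x ≠ h} u)

theorem fst_mem_componentEnds {V E : Type} [Fintype E] {inc : E → V × V} {h e : E} {u : V} :
    (inc e).1 ∈ componentEnds inc h u ↔ ReachableVia inc {x | x ≠ h} u (inc e).1 := by
  simp [componentEnds]

theorem snd_mem_componentEnds {V E : Type} [Fintype E] {inc : E → V × V} {h e : E} {u : V} :
    (inc e).2 ∈ componentEnds inc h u ↔ ReachableVia inc {x | x ≠ h} u (inc e).2 := by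
  simp [componentEnds]

theorem fst_mem_componentEnds_iff_snd_mem {V E : Type} [Fintype E] {inc : E → V × V} {h e : E}
    (he : e ≠ h) (u : V) :
    (inc e).1 ∈ componentEnds inc h u ↔ (inc e).2 ∈ componentEnds inc h u := by
  rw [fst_mem_componentEnds, snd_mem_componentEnds]
  exact ⟨fun hu => hu.tail ⟨e, he, .inl rfl⟩, fun hu => hu.tail ⟨e, he, .inr rfl⟩⟩

/-- Sink-existence theorem: for any h ∈ E and any run of the
canonical protocol 𝒫^δ_{{h}}, if □_hδ ∈ X^h, then there is an edge h' with
δ_{h'} ∈ X^{h'}. -/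
theorem sink_exists {V E P : Type} [Fintype E] (inc : E → V × V) (edgeOf : P → E)
    (hconn : ConnectedGraph inc)
    (d : E → Form E P) (hd : ∀ e : E, InLang edgeOf {e} (d e))
    (h : E) (r : (e : E) → CanValue E P)
    (hr : IsCanRun inc edgeOf d {h} r)
    (hbox : Form.box h (deltaForm d) ∈ (r h).X) :
    ∃ h' : E, d h' ∈ (r h').X := by
  by_contra! hno
  obtain ⟨hval, hlocal⟩ := hr
  have hle : ∀ e, (r e).f₁ + (r e).f₂ ≤ 0 := fun e =>
    not_lt.1 fun hpos => hno e ((hval e).2.1.1 hpos)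
  have key : ∀ u, 0 ≤ ∑ v ∈ componentEnds inc h u, flowAt inc (r h) h v := fun u =>
    sum_flowAt_nonneg_of_closed (fun v _ => hlocal v fun e _ => hno e) (fun e _ => hle e)
      fun e he => fst_mem_componentEnds_iff_snd_mem he u
  simp only [sum_flowAt] at key
  have key₁ := key (inc h).1
  have key₂ := key (inc h).2
  obtain ⟨-, -, -, -, -, hbridge, -, hnonbridge⟩ := hval h
  by_cases hb : IsBridge inc h
  · have hsep := hb.not_reachableVia hconn
    have hsep' : ¬ ReachableVia inc {x | x ≠ h} (inc h).2 (inc h).1 := fun hc => hsep hc.symm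
    rw [if_pos (fst_mem_componentEnds.2 .refl), if_neg (snd_mem_componentEnds.not.2 hsep)] at key₁
    rw [if_neg (fst_mem_componentEnds.not.2 hsep'), if_pos (snd_mem_componentEnds.2 .refl)] at key₂
    rcases hbridge hb rfl hbox (hno h) with hneg | hneg <;> linarith
  · have hreach : ∀ u v, ReachableVia inc {x | x ≠ h} u v := not_not.1 hb
    rw [if_pos (fst_mem_componentEnds.2 .refl),
      if_pos (snd_mem_componentEnds.2 (hreach _ _))] at key₁
    linarith [hnonbridge hb rfl hbox (hno h)]
end
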